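/- arXiv:1507.04258 — 9 statements merged into one kernel-verified Lean document; each statement's English description precedes it below -/
import Mathlib

section
/- Let G₀ be a finite simple graph with a partition V(G₀) = C ∪ I of its vertex set. If H is a minimal forbidden induced subgraph for the hereditary class 𝒢(G₀;C,I), then the number of vertices of H is at most 4|C||I| + 2|C| + 2|I| + 1. In particular, 𝒢(G₀;C,I) is characterized by a finite set of forbidden induced subgraphs. -/
/-- A graph `G` belongs to the class `𝒢(G₀;C,I)`: it arises from `G₀` by replacing
every vertex in `C` by a possibly empty clique and every vertex outside `C`
(i.e. in `I`) by a possibly empty independent set.  This is witnessed by a map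
`φ` sending each vertex of `G` to the original vertex it replaces. -/
def SimpleGraph.InBlowup {V W : Type*} (G0 : SimpleGraph V) (C : Set V)
    (G : SimpleGraph W) : Prop :=
  ∃ φ : W → V, ∀ w w' : W, w ≠ w' →
    (G.Adj w w' ↔ (φ w = φ w' ∧ φ w ∈ C) ∨ (φ w ≠ φ w' ∧ G0.Adj (φ w) (φ w')))

namespace SimpleGraph

variable {V W W' : Type*}

theorem InBlowup.of_embedding {G0 : SimpleGraph V} {C : Set V} {G : SimpleGraph W}
    {G' : SimpleGraph W'} (f : G' ↪g G) (h : InBlowup G0 C G) : InBlowup G0 C G' := by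
  obtain ⟨φ, hφ⟩ := h
  refine ⟨φ ∘ f, fun a b hab => ?_⟩
  rw [← f.map_adj_iff]
  exact hφ _ _ (f.injective.ne hab)

/-- A blowup map of `H - t` extends to `H` if some twin `x` of `t` is sent to a vertex of
the type (clique or independent) matching the adjacency of `x` and `t`. -/
theorem InBlowup.of_twin {G0 : SimpleGraph V} {C : Set V} {H : SimpleGraph W} {t x : W}
    (hxt : x ≠ t) (htwin : ∀ z, z ≠ t → z ≠ x → (H.Adj t z ↔ H.Adj x z))
    (ψ : W → V) (hψ : ∀ a b, a ≠ t → b ≠ t → a ≠ b →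
      (H.Adj a b ↔ (ψ a = ψ b ∧ ψ a ∈ C) ∨ (ψ a ≠ ψ b ∧ G0.Adj (ψ a) (ψ b))))
    (hx : H.Adj t x ↔ ψ x ∈ C) : InBlowup G0 C H := by
  classical
  have key : ∀ z, z ≠ t →
      (H.Adj t z ↔ (ψ x = ψ z ∧ ψ x ∈ C) ∨ (ψ x ≠ ψ z ∧ G0.Adj (ψ x) (ψ z))) := by
    intro z hz
    by_cases hzx : z = x
    · subst hzx
      simpa using hx
    · rw [htwin z hz hzx]
      exact hψ x z hxt hz (Ne.symm hzx)
  refine ⟨fun w => if w = t then ψ x else ψ w, fun a b hab => ?_⟩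
  by_cases ha : a = t
  · subst ha
    simpa [Ne.symm hab] using key b (Ne.symm hab)
  · by_cases hb : b = t
    · subst hb
      simp only [ha, if_false, if_true]
      rw [H.adj_comm, key a ha, G0.adj_comm]
      grind
    · simpa [ha, hb] using hψ a b ha hb hab

/-- In a minimal forbidden graph, a set of pairwise twins, all adjacent or all nonadjacent
according to `p`, has at most one more element than there are vertices of the opposite type. -/
theorem card_twins_le {G0 : SimpleGraph V} {C : Set V} {H : SimpleGraph W}
    (hforb : ¬ InBlowup G0 C H)
    (hmin : ∀ s : Set W, s ≠ Set.univ → InBlowup G0 C (H.induce s))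
    (p : Prop) (D : Finset V) (hD : ∀ u, u ∈ D ↔ ¬ (u ∈ C ↔ p)) (T : Finset W)
    (hadj : ∀ x ∈ T, ∀ y ∈ T, x ≠ y → (H.Adj x y ↔ p))
    (htwin : ∀ x ∈ T, ∀ y ∈ T, ∀ z, z ≠ x → z ≠ y → (H.Adj x z ↔ H.Adj y z)) :
    T.card ≤ D.card + 1 := by
  classical
  obtain rfl | ⟨t, ht⟩ := T.eq_empty_or_nonempty
  · simp
  obtain ⟨ψ₀, hψ₀⟩ := hmin {t}ᶜ (by simp)
  obtain hT | ⟨y, hy⟩ := (T.erase t).eq_empty_or_nonempty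
  · have := Finset.card_erase_of_mem ht
    rw [hT, Finset.card_empty] at this
    omega
  let ψ : W → V := fun w =>
    if h : w ≠ t then ψ₀ ⟨w, h⟩ else ψ₀ ⟨y, Finset.ne_of_mem_erase hy⟩
  have hψ : ∀ a b, a ≠ t → b ≠ t → a ≠ b →
      (H.Adj a b ↔ (ψ a = ψ b ∧ ψ a ∈ C) ∨ (ψ a ≠ ψ b ∧ G0.Adj (ψ a) (ψ b))) := by
    intro a b ha hb hab
    have := hψ₀ ⟨a, ha⟩ ⟨b, hb⟩ (fun h => hab (congrArg Subtype.val h))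
    simpa [ψ, ha, hb] using this
  have hle : (T.erase t).card ≤ D.card := by
    refine Finset.card_le_card_of_injOn ψ (fun x hx => ?_) (fun x hx z hz hxz => ?_)
    · obtain ⟨hxt, hxT⟩ := Finset.mem_erase.1 hx
      refine (hD _).2 fun h => hforb ?_
      exact InBlowup.of_twin hxt (fun z hz hzx => htwin t ht x hxT z hz hzx) ψ hψ
        ((hadj t ht x hxT hxt.symm).trans h.symm)
    · obtain ⟨hxt, hxT⟩ := Finset.mem_erase.1 hx
      obtain ⟨hzt, hzT⟩ := Finset.mem_erase.1 hz
      by_contra hne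
      refine hforb (InBlowup.of_twin hxt (fun z hz hzx => htwin t ht x hxT z hz hzx) ψ hψ
        ((hadj t ht x hxT hxt.symm).trans ?_))
      rw [← hadj x hxT z hzT hne, hψ x z hxt hzt hne]
      simp [hxz]
  rw [Finset.card_erase_of_mem ht] at hle
  omega

theorem card_le_of_minimal_forbidden [Fintype W] (G0 : SimpleGraph V) (C I : Finset V)
    (hunion : ∀ v : V, v ∈ C ∨ v ∈ I) (hdisj : ∀ v : V, ¬ (v ∈ C ∧ v ∈ I))
    (H : SimpleGraph W) (hforb : ¬ InBlowup G0 (↑C) H)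
    (hmin : ∀ s : Set W, s ≠ Set.univ → InBlowup G0 (↑C) (H.induce s)) :
    Fintype.card W ≤ 4 * C.card * I.card + 2 * C.card + 2 * I.card + 1 := by
  classical
  obtain hW | ⟨⟨v⟩⟩ := isEmpty_or_nonempty W
  · simp
  obtain ⟨φ, hφ⟩ := hmin {v}ᶜ (by simp)
  let S := ({v}ᶜ : Set W)
  -- The fibres of `q` are sets of pairwise twins of `H`.
  let q : S → V × Prop := fun w => (φ w, H.Adj v w)
  have fiber (k : V × Prop) (D : Finset V) (hD : ∀ u, u ∈ D ↔ ¬ (u ∈ C ↔ k.1 ∈ C)) :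
      (Finset.univ.filter fun w => q w = k).card ≤ D.card + 1 := by
    rw [← Finset.card_map (Function.Embedding.subtype (· ∈ S))]
    refine card_twins_le hforb hmin (k.1 ∈ C) D (by simpa using hD) _ ?_ ?_
    · simp only [Finset.mem_map, Finset.mem_filter, Finset.mem_univ, true_and]
      rintro _ ⟨x, rfl, rfl⟩ _ ⟨y, hy, rfl⟩ hne
      have hxy : φ y = φ x := congrArg Prod.fst hy
      have := hφ x y (fun h => hne (by rw [h]))
      simpa [hxy, q] using this
    · simp only [Finset.mem_map, Finset.mem_filter, Finset.mem_univ, true_and]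
      rintro _ ⟨x, rfl, rfl⟩ _ ⟨y, hy, rfl⟩ z hzx hzy
      have hxy : φ y = φ x := congrArg Prod.fst hy
      have hv : H.Adj v y = H.Adj v x := congrArg Prod.snd hy
      by_cases hz : z = v
      · subst hz
        rw [H.adj_comm, H.adj_comm _ z]
        exact (Iff.of_eq hv).symm
      · have hx' := hφ x ⟨z, hz⟩ (fun h => hzx (by rw [h]; rfl))
        have hy' := hφ y ⟨z, hz⟩ (fun h => hzy (by rw [h]; rfl))
        rw [hxy] at hy'
        exact hx'.trans hy'.symm
  have hdisjoint : Disjoint C I :=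
    Finset.disjoint_left.2 fun v hC hI => hdisj v ⟨hC, hI⟩
  have hcard : Fintype.card S =
      ∑ k ∈ (C ∪ I) ×ˢ (Finset.univ : Finset Prop),
        (Finset.univ.filter fun w => q w = k).card := by
    rw [← Finset.card_univ]
    refine Finset.card_eq_sum_card_fiberwise fun w _ => ?_
    simpa [q, Classical.em] using hunion (φ w)
  have hC : ∑ k ∈ C ×ˢ (Finset.univ : Finset Prop),
      (Finset.univ.filter fun w => q w = k).card ≤ (C.card * 2) * (I.card + 1) := by
    refine (Finset.sum_le_card_nsmul _ _ (I.card + 1) fun k hk => fiber k I ?_).trans ?_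
    · have := (Finset.mem_product.1 hk).1
      grind
    · simp
  have hI : ∑ k ∈ I ×ˢ (Finset.univ : Finset Prop),
      (Finset.univ.filter fun w => q w = k).card ≤ (I.card * 2) * (C.card + 1) := by
    refine (Finset.sum_le_card_nsmul _ _ (C.card + 1) fun k hk => fiber k C ?_).trans ?_
    · have := (Finset.mem_product.1 hk).1
      grind
    · simp
  have hdisjoint' : Disjoint (C ×ˢ (Finset.univ : Finset Prop)) (I ×ˢ Finset.univ) :=
    Finset.disjoint_product.2 (Or.inl hdisjoint)
  rw [Finset.union_product, Finset.sum_union hdisjoint'] at hcard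
  have hS : Fintype.card S = Fintype.card W - 1 := by
    rw [Fintype.card_compl_set, Set.card_singleton]
  have hbound : Fintype.card S ≤ (C.card * 2) * (I.card + 1) + (I.card * 2) * (C.card + 1) :=
    hcard.trans_le (add_le_add hC hI)
  have : (C.card * 2) * (I.card + 1) + (I.card * 2) * (C.card + 1) =
      4 * C.card * I.card + 2 * C.card + 2 * I.card := by ring
  omega

/-- A finite graph outside the class contains a minimal forbidden induced subgraph. -/
theorem exists_minimal_forbidden [Finite W] {G0 : SimpleGraph V} {C : Set V}
    {G : SimpleGraph W} (hG : ¬ InBlowup G0 C G) :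
    ∃ s : Set W, ¬ InBlowup G0 C (G.induce s) ∧
      ∀ r : Set s, r ≠ Set.univ → InBlowup G0 C ((G.induce s).induce r) := by
  obtain ⟨s, hs⟩ := (Set.toFinite {s : Set W | ¬ InBlowup G0 C (G.induce s)}).exists_minimal
    ⟨Set.univ, fun h => hG (h.of_embedding (induceUnivIso G).symm.toEmbedding)⟩
  refine ⟨s, hs.prop, fun r hr => ?_⟩
  by_contra hnot
  have hmem : ¬ InBlowup G0 C (G.induce (Set.image Subtype.val r)) := by
    intro h
    refine hnot (h.of_embedding ⟨⟨fun a => ⟨a.1.1, a.1, a.2, rfl⟩, fun a b hab => ?_⟩, ?_⟩)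
    · exact Subtype.ext (Subtype.ext (Subtype.mk.inj hab))
    · exact Iff.rfl
  have hsub := hs.le_of_le hmem (Subtype.coe_image_subset s r)
  refine hr (Set.eq_univ_of_forall fun x => ?_)
  obtain ⟨y, hy, hyx⟩ := hsub x.2
  rwa [← Subtype.ext hyx]

end SimpleGraph

/-- Theorem 1: every minimal forbidden induced subgraph `H` for `𝒢(G₀;C,I)` has order
at most `4|C||I| + 2|C| + 2|I| + 1`; in particular, membership in `𝒢(G₀;C,I)` is
determined by the induced subgraphs of order at most this bound, i.e. the class is
characterized by a finite set of forbidden induced subgraphs. -/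
theorem minimal_forbidden_order_le {V W : Type*} [Fintype V] [Fintype W]
    (G0 : SimpleGraph V) (C I : Finset V)
    (hunion : ∀ v : V, v ∈ C ∨ v ∈ I) (hdisj : ∀ v : V, ¬ (v ∈ C ∧ v ∈ I))
    (H : SimpleGraph W)
    (hforb : ¬ SimpleGraph.InBlowup G0 (↑C) H)
    (hmin : ∀ s : Set W, s ≠ Set.univ → SimpleGraph.InBlowup G0 (↑C) (H.induce s)) :
    Fintype.card W ≤ 4 * C.card * I.card + 2 * C.card + 2 * I.card + 1 ∧
    (∀ (W' : Type) [Fintype W'] (G : SimpleGraph W'),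
      SimpleGraph.InBlowup G0 (↑C) G ↔
        ∀ s : Finset W', s.card ≤ 4 * C.card * I.card + 2 * C.card + 2 * I.card + 1 →
          SimpleGraph.InBlowup G0 (↑C) (G.induce (↑s : Set W'))) := by
  refine ⟨SimpleGraph.card_le_of_minimal_forbidden G0 C I hunion hdisj H hforb hmin,
    fun W' _ G => ⟨fun h s _ => h.of_embedding (SimpleGraph.Embedding.induce _), fun h => ?_⟩⟩
  classical
  by_contra hG
  obtain ⟨s, hs, hsmin⟩ := SimpleGraph.exists_minimal_forbidden hG
  have hcard := SimpleGraph.card_le_of_minimal_forbidden G0 C I hunion hdisj _ hs hsmin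
  refine hs ?_
  have := h s.toFinset (by rwa [Set.toFinset_card])
  rwa [Set.coe_toFinset] at this
end

section
/- Let G₀ be a finite simple graph with a partition V(G₀) = C ∪ I of its vertex set, and let H be a minimal forbidden induced subgraph for the class 𝒢(G₀;C,I). Then H does not contain |I| + 2 vertices u₁, …, u_k that pairwise have the same closed neighborhood in H; that is, for every vertex u of H, at most |I| further vertices of H have the same closed neighborhood as u. -/
/-- Adding a closed twin `u` of a vertex `v` that is sent to a clique vertex preserves
membership in the class. -/
theorem SimpleGraph.inBlowup_of_closed_twin {V W : Type*} {G0 : SimpleGraph V} {C : Set V}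
    {H : SimpleGraph W} {u v : W} (hvu : v ≠ u)
    (htwin : insert v (H.neighborSet v) = insert u (H.neighborSet u)) (φ : W → V)
    (hφ : ∀ w w' : W, w ≠ u → w' ≠ u → w ≠ w' →
      (H.Adj w w' ↔ (φ w = φ w' ∧ φ w ∈ C) ∨ (φ w ≠ φ w' ∧ G0.Adj (φ w) (φ w'))))
    (hv : φ v ∈ C) : G0.InBlowup C H := by
  classical
  have hadj : ∀ x, (x = v ∨ H.Adj v x) ↔ (x = u ∨ H.Adj u x) := by
    simpa [Set.ext_iff] using htwin
  have key : ∀ w, w ≠ u →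
      (H.Adj u w ↔ (φ v = φ w ∧ φ v ∈ C) ∨ (φ v ≠ φ w ∧ G0.Adj (φ v) (φ w))) := by
    intro w hw
    by_cases hwv : w = v
    · subst hwv
      have := (hadj w).1 (Or.inl rfl)
      tauto
    · rw [← hφ v w hvu hw (Ne.symm hwv)]
      have := hadj w
      tauto
  refine ⟨Function.update φ u (φ v), fun w w' hww' => ?_⟩
  by_cases hw : w = u
  · subst hw
    simpa [Function.update_of_ne hww'.symm] using key w' hww'.symm
  · by_cases hw' : w' = u
    · subst hw'
      rw [H.adj_comm, Function.update_of_ne hw, Function.update_self, key w hw, G0.adj_comm]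
      grind
    · rw [Function.update_of_ne hw, Function.update_of_ne hw']
      exact hφ w w' hw hw' hww'

/-- If `H` is a minimal forbidden induced subgraph for `𝒢(G₀;C,I)`, then for every
vertex `u` of `H` at most `|I|` further vertices of `H` have the same closed
neighborhood as `u`; equivalently, `H` does not contain `|I| + 2` vertices that
pairwise have the same closed neighborhood. -/
theorem minimal_forbidden_closed_twins {V W : Type*} [Fintype V] [Fintype W]
    (G0 : SimpleGraph V) (C I : Finset V)
    (hunion : ∀ v : V, v ∈ C ∨ v ∈ I) (hdisj : ∀ v : V, ¬ (v ∈ C ∧ v ∈ I))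
    (H : SimpleGraph W)
    (hforb : ¬ SimpleGraph.InBlowup G0 (↑C) H)
    (hmin : ∀ s : Set W, s ≠ Set.univ → SimpleGraph.InBlowup G0 (↑C) (H.induce s)) :
    ∀ u : W,
      {v : W | v ≠ u ∧ insert v (H.neighborSet v) = insert u (H.neighborSet u)}.ncard
        ≤ I.card := by
  intro u
  obtain ⟨ψ, hψ⟩ := hmin {w | w ≠ u} (fun h => (h ▸ Set.mem_univ u : u ∈ {w | w ≠ u}) rfl)
  by_contra! hlt
  have hex : ∃ v : W, v ≠ u := by
    obtain ⟨v, hv⟩ := Set.nonempty_of_ncard_ne_zero (Nat.ne_zero_of_lt hlt)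
    exact ⟨v, hv.1⟩
  classical
  let φ : W → V := fun w => if h : w ≠ u then ψ ⟨w, h⟩ else ψ ⟨hex.choose, hex.choose_spec⟩
  have hφ : ∀ w w' : W, w ≠ u → w' ≠ u → w ≠ w' →
      (H.Adj w w' ↔ (φ w = φ w' ∧ φ w ∈ (↑C : Set V)) ∨
        (φ w ≠ φ w' ∧ G0.Adj (φ w) (φ w'))) := by
    intro w w' hw hw' hww'
    simpa [φ, hw, hw'] using hψ ⟨w, hw⟩ ⟨w', hw'⟩ (by simpa using hww')
  refine hlt.not_ge ?_
  rw [← Set.ncard_coe_finset]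
  refine Set.ncard_le_ncard_of_injOn φ (fun v hv => ?_) (fun v hv w hw hvw => ?_) I.finite_toSet
  · refine (hunion (φ v)).resolve_left fun hC => hforb ?_
    exact SimpleGraph.inBlowup_of_closed_twin hv.1 hv.2 φ hφ hC
  · by_contra hne
    have hmem : w ∈ insert v (H.neighborSet v) := by
      rw [hv.2, ← hw.2]; exact Set.mem_insert _ _
    have hadj : H.Adj v w := hmem.resolve_left (Ne.symm hne)
    rcases (hφ v w hv.1 hw.1 hne).1 hadj with h | h
    · exact hforb (SimpleGraph.inBlowup_of_closed_twin hv.1 hv.2 φ hφ h.2)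
    · exact h.1 hvw
end

section
/- Let G₀ be a finite simple graph with a partition V(G₀) = C ∪ I of its vertex set, and let H be a minimal forbidden induced subgraph for the class 𝒢(G₀;C,I). Then for every vertex u of H, at most |C| further vertices of H have the same open neighborhood as u. -/
/-- Vertices with the same open neighborhood are not adjacent. -/
theorem SimpleGraph.not_adj_of_neighborSet_eq {W : Type*} {H : SimpleGraph W} {v w : W}
    (h : H.neighborSet v = H.neighborSet w) : ¬ H.Adj v w := fun hvw =>
  H.loopless.irrefl w (h ▸ hvw : w ∈ H.neighborSet w)

/-- If `H` minus `u` is a blow-up in which an open twin `v` of `u` lies in an independent part,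
then `H` is a blow-up: `u` can be added to the part of `v`. -/
theorem SimpleGraph.inBlowup_of_twin {V W : Type*} {G0 : SimpleGraph V} {C : Set V}
    {H : SimpleGraph W} {u v : W} (φ : W → V)
    (hφ : ∀ w w' : W, w ≠ u → w' ≠ u → w ≠ w' →
      (H.Adj w w' ↔ (φ w = φ w' ∧ φ w ∈ C) ∨ (φ w ≠ φ w' ∧ G0.Adj (φ w) (φ w'))))
    (hvu : v ≠ u) (htwin : H.neighborSet v = H.neighborSet u) (hv : φ v ∉ C) :
    G0.InBlowup C H := by
  classical
  have hadj (w : W) : H.Adj v w ↔ H.Adj u w := Set.ext_iff.mp htwin w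
  have key (w : W) (hw : w ≠ u) :
      H.Adj u w ↔ (φ v = φ w ∧ φ v ∈ C) ∨ (φ v ≠ φ w ∧ G0.Adj (φ v) (φ w)) := by
    rw [← hadj]
    by_cases hvw : v = w
    · subst hvw
      simp [hv]
    · exact hφ v w hvu hw hvw
  refine ⟨Function.update φ u (φ v), fun w w' hne => ?_⟩
  by_cases hw : w = u
  · subst hw
    simpa [Function.update_of_ne hne.symm] using key w' hne.symm
  · by_cases hw' : w' = u
    · subst hw'
      rw [H.adj_comm, key w hw, Function.update_self, Function.update_of_ne hw,
        G0.adj_comm, ne_comm, eq_comm]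
      exact or_congr_left (and_congr_right fun h => by rw [h])
    · rw [Function.update_of_ne hw, Function.update_of_ne hw']
      exact hφ w w' hw hw' hne

/-- If `H` is a minimal forbidden induced subgraph for `𝒢(G₀;C,I)`, then for every
vertex `u` of `H` at most `|C|` further vertices of `H` have the same open
neighborhood as `u`. -/
theorem minimal_forbidden_open_twins {V W : Type*} [Fintype V] [Fintype W]
    (G0 : SimpleGraph V) (C I : Finset V)
    (hunion : ∀ v : V, v ∈ C ∨ v ∈ I) (hdisj : ∀ v : V, ¬ (v ∈ C ∧ v ∈ I))
    (H : SimpleGraph W)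
    (hforb : ¬ SimpleGraph.InBlowup G0 (↑C) H)
    (hmin : ∀ s : Set W, s ≠ Set.univ → SimpleGraph.InBlowup G0 (↑C) (H.induce s)) :
    ∀ u : W,
      {v : W | v ≠ u ∧ H.neighborSet v = H.neighborSet u}.ncard ≤ C.card := by
  classical
  intro u
  obtain ⟨φ₀, hφ₀⟩ := hmin {u}ᶜ (by simp)
  by_contra! hcard
  obtain ⟨x, hxu, -⟩ := Set.nonempty_of_ncard_ne_zero (Nat.ne_zero_of_lt hcard)
  let φ : W → V := fun w => if h : w ≠ u then φ₀ ⟨w, h⟩ else φ₀ ⟨x, hxu⟩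
  have hφ (w w' : W) (hw : w ≠ u) (hw' : w' ≠ u) (hne : w ≠ w') :
      H.Adj w w' ↔ (φ w = φ w' ∧ φ w ∈ (C : Set V)) ∨
        (φ w ≠ φ w' ∧ G0.Adj (φ w) (φ w')) := by
    simpa only [φ, dif_pos hw, dif_pos hw', SimpleGraph.comap_adj,
      Function.Embedding.subtype_apply] using
      hφ₀ ⟨w, hw⟩ ⟨w', hw'⟩ fun h => hne (congrArg Subtype.val h)
  have hmaps : ∀ v ∈ {v : W | v ≠ u ∧ H.neighborSet v = H.neighborSet u}, φ v ∈ (C : Set V) :=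
    fun v hv => by_contra fun hvC => hforb (G0.inBlowup_of_twin φ hφ hv.1 hv.2 hvC)
  refine hcard.not_ge ?_
  rw [← Set.ncard_coe_finset C]
  refine Set.ncard_le_ncard_of_injOn φ hmaps fun v hv w hw hvw => by_contra fun hne => ?_
  exact SimpleGraph.not_adj_of_neighborSet_eq (hv.2.trans hw.2.symm)
    ((hφ v w hv.1 hw.1 hne).mpr (Or.inl ⟨hvw, hmaps v hv⟩))
end

section
/- For all positive integers d and p, every minimal forbidden induced subgraph for the class 𝒢(d,p) of graphs with p-intersection number at most d has at most 3·2^{d+1} + 1 vertices. -/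
/-- The `p`-intersection number `Θ_p(G)`: the minimum cardinality `d` of a ground
set `U` (represented as `Fin d`) for which `G` has a `p`-intersection
representation `S : V(G) → 2^U`, i.e. distinct vertices `u` and `v` are adjacent
if and only if `|S(u) ∩ S(v)| ≥ p`. -/
noncomputable def SimpleGraph.pIntersectionNumber {V : Type*} (G : SimpleGraph V)
    (p : ℕ) : ℕ :=
  sInf {d : ℕ | ∃ S : V → Finset (Fin d),
    ∀ u v : V, u ≠ v → (G.Adj u v ↔ p ≤ (S u ∩ S v).card)}

theorem SimpleGraph.pIntersectionNumber_le_of_representation {V : Type*} {G : SimpleGraph V} {p d : ℕ}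
    (S : V → Finset (Fin d))
    (hS : ∀ u v : V, u ≠ v → (G.Adj u v ↔ p ≤ (S u ∩ S v).card)) :
    G.pIntersectionNumber p ≤ d :=
  Nat.sInf_le ⟨S, hS⟩

/-- A representation over a finite type can be moved to `Fin d` for every `d` that is at least
the cardinality of the type. -/
theorem SimpleGraph.exists_fin_representation {V U : Type*} [Fintype U] [DecidableEq U]
    {G : SimpleGraph V} {p d : ℕ} (hd : Fintype.card U ≤ d) (S : V → Finset U)
    (hS : ∀ u v : V, u ≠ v → (G.Adj u v ↔ p ≤ (S u ∩ S v).card)) :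
    ∃ T : V → Finset (Fin d), ∀ u v : V, u ≠ v → (G.Adj u v ↔ p ≤ (T u ∩ T v).card) := by
  obtain ⟨f⟩ : Nonempty (U ↪ Fin d) :=
    Function.Embedding.nonempty_of_card_le (by simpa using hd)
  refine ⟨fun u => (S u).map f, fun u v huv => ?_⟩
  rw [hS u v huv, ← Finset.map_inter, Finset.card_map]

/-- Every finite graph has a `p`-intersection representation, using `p` private elements for
each edge. -/
theorem SimpleGraph.exists_representation {V : Type*} [Finite V] (G : SimpleGraph V) {p : ℕ}
    (hp : 0 < p) :
    ∃ d : ℕ, ∃ S : V → Finset (Fin d),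
      ∀ u v : V, u ≠ v → (G.Adj u v ↔ p ≤ (S u ∩ S v).card) := by
  classical
  have := Fintype.ofFinite V
  refine ⟨_, SimpleGraph.exists_fin_representation (U := Sym2 V × Fin p) le_rfl
    (fun u => {e : Sym2 V | e ∈ G.edgeSet ∧ u ∈ e}.toFinset ×ˢ Finset.univ) fun u v huv => ?_⟩
  rw [← Finset.inter_product, Finset.card_product, Finset.card_univ, Fintype.card_fin]
  constructor
  · intro h
    refine Nat.le_mul_of_pos_left p (Finset.card_pos.2 ⟨s(u, v), ?_⟩)
    simpa using h
  · intro h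
    have hpos := Nat.pos_of_mul_pos_right (hp.trans_le h)
    obtain ⟨e, he⟩ := Finset.card_pos.1 hpos
    simp only [Finset.mem_inter, Set.mem_toFinset, Set.mem_ofPred_eq] at he
    have : e = s(u, v) := (Sym2.mem_and_mem_iff huv).1 ⟨he.1.2, he.2.2⟩
    simpa [this] using he.1.1

theorem SimpleGraph.exists_representation_of_pIntersectionNumber_le {V : Type*} [Finite V]
    {G : SimpleGraph V} {p d : ℕ} (hp : 0 < p) (h : G.pIntersectionNumber p ≤ d) :
    ∃ S : V → Finset (Fin d), ∀ u v : V, u ≠ v → (G.Adj u v ↔ p ≤ (S u ∩ S v).card) := by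
  obtain ⟨S, hS⟩ := Nat.sInf_mem (G.exists_representation hp)
  exact SimpleGraph.exists_fin_representation
    (by rw [Fintype.card_fin]; exact h) S hS

/-- If `G - v` has `p`-intersection number at most `d`, there is a set assignment on all of `G`
that represents `G` away from `v`. -/
theorem SimpleGraph.exists_representation_away {V : Type*} [Finite V]
    {G : SimpleGraph V} {p d : ℕ} (hp : 0 < p) (v : V)
    (h : (G.induce {v}ᶜ).pIntersectionNumber p ≤ d) :
    ∃ S : V → Finset (Fin d), ∀ x y : V, x ≠ v → y ≠ v → x ≠ y →
      (G.Adj x y ↔ p ≤ (S x ∩ S y).card) := by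
  classical
  obtain ⟨S, hS⟩ := SimpleGraph.exists_representation_of_pIntersectionNumber_le hp h
  refine ⟨fun x => if hx : x ∈ ({v}ᶜ : Set V) then S ⟨x, hx⟩ else ∅, fun x y hx hy hxy => ?_⟩
  have hx' : x ∈ ({v}ᶜ : Set V) := hx
  have hy' : y ∈ ({v}ᶜ : Set V) := hy
  simp only [dif_pos hx', dif_pos hy']
  rw [← hS ⟨x, hx'⟩ ⟨y, hy'⟩ (by simpa using hxy)]
  rfl

/-- A set assignment representing `G` away from `v` can be corrected at `v` alone. -/
theorem SimpleGraph.pIntersectionNumber_le_of_away {V : Type*} {G : SimpleGraph V} {p d : ℕ}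
    (v : V) (S : V → Finset (Fin d)) (A : Finset (Fin d))
    (hS : ∀ x y : V, x ≠ v → y ≠ v → x ≠ y → (G.Adj x y ↔ p ≤ (S x ∩ S y).card))
    (hA : ∀ x, x ≠ v → (G.Adj v x ↔ p ≤ (A ∩ S x).card)) :
    G.pIntersectionNumber p ≤ d := by
  classical
  refine SimpleGraph.pIntersectionNumber_le_of_representation (Function.update S v A) fun x y hxy => ?_
  by_cases hx : x = v
  · subst hx
    simpa [Function.update_of_ne hxy.symm] using hA y hxy.symm
  · by_cases hy : y = v
    · subst hy
      simpa [Function.update_of_ne hx, G.adj_comm x, Finset.inter_comm (S x)] using hA x hx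
    · simpa [Function.update_of_ne hx, Function.update_of_ne hy] using hS x y hx hy hxy

/-- A graph outside `𝒢(d,p)` all of whose vertex-deleted subgraphs are in `𝒢(d,p)` has no
isolated vertex. -/
theorem SimpleGraph.exists_adj_of_minimal {W : Type*} [Finite W] {d p : ℕ} (hp : 0 < p)
    {H : SimpleGraph W} (hforb : ¬ H.pIntersectionNumber p ≤ d)
    (hdel : ∀ v, (H.induce {v}ᶜ).pIntersectionNumber p ≤ d) (v : W) : ∃ w, H.Adj v w := by
  by_contra! hiso
  obtain ⟨S, hS⟩ := SimpleGraph.exists_representation_away hp v (hdel v)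
  refine hforb (SimpleGraph.pIntersectionNumber_le_of_away v S ∅ hS fun x _ => ?_)
  simp [hiso x, hp.ne']

/-- In a minimal graph outside `𝒢(d,p)`, adjacent vertices with a further common neighbour are
distinguished by a third vertex. -/
theorem SimpleGraph.not_twins_of_minimal {W : Type*} [Finite W] {d p : ℕ} (hp : 0 < p)
    {H : SimpleGraph W} (hforb : ¬ H.pIntersectionNumber p ≤ d)
    (hdel : ∀ v, (H.induce {v}ᶜ).pIntersectionNumber p ≤ d) {x y z : W} (hxy : H.Adj x y)
    (hyz : H.Adj y z) (hzx : z ≠ x)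
    (htwin : ∀ w, w ≠ x → w ≠ y → (H.Adj x w ↔ H.Adj y w)) : False := by
  obtain ⟨S, hS⟩ := SimpleGraph.exists_representation_away hp x (hdel x)
  refine hforb (SimpleGraph.pIntersectionNumber_le_of_away x S (S y) hS fun w hw => ?_)
  by_cases hwy : w = y
  · subst hwy
    have hcard := (hS w z hw hzx hyz.ne).1 hyz
    simpa [hxy] using hcard.trans (Finset.card_le_card Finset.inter_subset_left)
  · rw [htwin w hw hwy, hS y w hxy.ne' hw (Ne.symm hwy)]

/-- In a minimal graph outside `𝒢(d,p)`, few vertices become isolated when `v` is deleted. -/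
theorem SimpleGraph.card_pendant_le_of_minimal {W : Type*} [Finite W] {d p : ℕ} (hp : 0 < p)
    {H : SimpleGraph W} (hforb : ¬ H.pIntersectionNumber p ≤ d)
    (hdel : ∀ v, (H.induce {v}ᶜ).pIntersectionNumber p ≤ d) (v : W) (P : Finset W)
    (hP : ∀ x ∈ P, x ≠ v ∧ ∀ w, w ≠ v → ¬ H.Adj x w) : P.card ≤ 2 ^ d + 1 := by
  classical
  obtain rfl | ⟨a, ha⟩ := P.eq_empty_or_nonempty
  · simp
  obtain ⟨S, hS⟩ := SimpleGraph.exists_representation_away hp a (hdel a)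
  have hinj : Set.InjOn S (P.erase a) := by
    intro x hx y hy hxy
    simp only [Finset.coe_erase, Set.mem_sdiff, Finset.mem_coe, Set.mem_singleton_iff] at hx hy
    by_contra hne
    obtain ⟨w, hw⟩ := SimpleGraph.exists_adj_of_minimal hp hforb hdel x
    have hwv : w = v := by
      by_contra hwv
      exact (hP x hx.1).2 w hwv hw
    subst hwv
    refine (hP x hx.1).2 y (hP y hy.1).1 ((hS x y hx.2 hy.2 hne).2 ?_)
    rw [← hxy, Finset.inter_self]
    exact ((hS x w hx.2 (hP a ha).1.symm hw.ne).1 hw).trans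
      (Finset.card_le_card Finset.inter_subset_left)
  have hle := Finset.card_le_card_of_injOn S (t := Finset.univ) (by simp) hinj
  rw [Finset.card_univ, Fintype.card_finset, Fintype.card_fin, Finset.card_erase_of_mem ha] at hle
  omega

/-- In a minimal graph outside `𝒢(d,p)`, at most `2 ^ (d + 1)` vertices are not isolated once
`v` is deleted. -/
theorem SimpleGraph.card_nonpendant_le_of_minimal {W : Type*} [Finite W] {d p : ℕ} (hp : 0 < p)
    {H : SimpleGraph W} (hforb : ¬ H.pIntersectionNumber p ≤ d)
    (hdel : ∀ v, (H.induce {v}ᶜ).pIntersectionNumber p ≤ d) (v : W) (Q : Finset W)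
    (hQ : ∀ x ∈ Q, x ≠ v ∧ ∃ w, w ≠ v ∧ H.Adj x w) : Q.card ≤ 2 ^ (d + 1) := by
  classical
  obtain ⟨S, hS⟩ := SimpleGraph.exists_representation_away hp v (hdel v)
  have hadj : ∀ x ∈ Q, ∀ y ∈ Q, S x = S y → x ≠ y → H.Adj x y := by
    intro x hx y hy hxy hne
    obtain ⟨hxv, w, hwv, hw⟩ := hQ x hx
    refine (hS x y hxv (hQ y hy).1 hne).2 ?_
    rw [← hxy, Finset.inter_self]
    exact ((hS x w hxv hwv hw.ne).1 hw).trans (Finset.card_le_card Finset.inter_subset_left)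
  have hdist : ∀ x ∈ Q, ∀ y ∈ Q, ∀ z ∈ Q, S x = S y → S y = S z → x ≠ y → y ≠ z → z ≠ x →
      ¬ (H.Adj x v ↔ H.Adj y v) := by
    intro x hx y hy z hz hxy hyz hne hyz' hzx hv
    refine SimpleGraph.not_twins_of_minimal hp hforb hdel (hadj x hx y hy hxy hne)
      (hadj y hy z hz hyz hyz') hzx fun w hwx hwy => ?_
    by_cases hwv : w = v
    · rwa [hwv]
    · rw [hS x w (hQ x hx).1 hwv hwx.symm, hS y w (hQ y hy).1 hwv hwy.symm, hxy]
  have hfibre : ∀ A ∈ (Finset.univ : Finset (Finset (Fin d))),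
      (Q.filter fun x => S x = A).card ≤ 2 := by
    intro A _
    by_contra! hlt
    obtain ⟨a, b, c, ha, hb, hc, hab, hac, hbc⟩ := Finset.two_lt_card_iff.1 hlt
    rw [Finset.mem_filter] at ha hb hc
    have h₁ := hdist a ha.1 b hb.1 c hc.1 (ha.2.trans hb.2.symm) (hb.2.trans hc.2.symm)
      hab hbc hac.symm
    have h₂ := hdist b hb.1 c hc.1 a ha.1 (hb.2.trans hc.2.symm) (hc.2.trans ha.2.symm)
      hbc hac.symm hab
    have h₃ := hdist c hc.1 a ha.1 b hb.1 (hc.2.trans ha.2.symm) (ha.2.trans hb.2.symm)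
      hac.symm hab hbc
    tauto
  have hle := Finset.card_le_mul_card_image_of_maps_to (f := S) (fun x _ => Finset.mem_univ (S x))
    2 hfibre
  rw [Finset.card_univ, Fintype.card_finset, Fintype.card_fin] at hle
  rw [pow_succ]
  omega

/-- Corollary 1: for positive integers `d` and `p`, every minimal forbidden induced
subgraph `H` for the class `𝒢(d,p) = {G : Θ_p(G) ≤ d}` has order at most
`3·2^(d+1) + 1`. -/
theorem minimal_forbidden_pIntersection_order_le {W : Type*} [Fintype W]
    (d p : ℕ) (hd : 0 < d) (hp : 0 < p) (H : SimpleGraph W)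
    (hforb : ¬ H.pIntersectionNumber p ≤ d)
    (hmin : ∀ s : Set W, s ≠ Set.univ → (H.induce s).pIntersectionNumber p ≤ d) :
    Fintype.card W ≤ 3 * 2 ^ (d + 1) + 1 := by
  classical
  obtain hW | ⟨⟨v⟩⟩ := isEmpty_or_nonempty W
  · simp
  have hdel : ∀ v, (H.induce {v}ᶜ).pIntersectionNumber p ≤ d := fun v =>
    hmin _ fun h => (h ▸ Set.mem_univ v : v ∈ ({v}ᶜ : Set W)) rfl
  have hpendant := SimpleGraph.card_pendant_le_of_minimal hp hforb hdel v
    ((Finset.univ.erase v).filter fun x => ∀ w, w ≠ v → ¬ H.Adj x w) (by simp)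
  have hrest := SimpleGraph.card_nonpendant_le_of_minimal hp hforb hdel v
    ((Finset.univ.erase v).filter fun x => ¬ ∀ w, w ≠ v → ¬ H.Adj x w) (by simp)
  have hsum := Finset.card_filter_add_card_filter_not (s := Finset.univ.erase v)
    fun x => ∀ w, w ≠ v → ¬ H.Adj x w
  rw [Finset.card_erase_of_mem (Finset.mem_univ v), Finset.card_univ] at hsum
  have hone : 1 ≤ 2 ^ d := Nat.one_le_two_pow
  rw [pow_succ] at hrest ⊢
  omega
end

section
/- For all positive integers d and p, the star K_{1,k} with k = C(d,p) + 1 leaves (where C(d,p) is the binomial coefficient d choose p) satisfies Θ_p(K_{1,k}) > d; that is, K_{1,k} has no binary dot product representation of dimension d with threshold p. -/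
/-- The dot product of two 0/1-vectors of dimension `d`. -/
def boolDot {d : ℕ} (x y : Fin d → Bool) : ℕ :=
  (Finset.univ.filter fun i => x i = true ∧ y i = true).card

/-- `f` is a binary dot product representation of `G` of dimension `d` with
threshold `p`. -/
def SimpleGraph.IsBinaryDotRep {V : Type*} (G : SimpleGraph V) (d p : ℕ)
    (f : V → (Fin d → Bool)) : Prop :=
  ∀ u v : V, u ≠ v → (G.Adj u v ↔ p ≤ boolDot (f u) (f v))

/-- The star `K_{1,k}`: the center `none` is adjacent to the `k` leaves `some i`. -/
def starGraph (k : ℕ) : SimpleGraph (Option (Fin k)) :=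
  SimpleGraph.fromRel (fun u v => u = none ∧ v ≠ none)

open Finset

theorem starGraph_adj_none_some {k : ℕ} (i : Fin k) : (starGraph k).Adj none (some i) := by
  simp [starGraph]

theorem starGraph_not_adj_some_some {k : ℕ} (i j : Fin k) :
    ¬ (starGraph k).Adj (some i) (some j) := by
  simp [starGraph]

/-- A star with a `p`-intersection representation on `d` points has at most `C(d,p)` leaves:
choosing `p` common points of the center and each leaf gives distinct `p`-subsets. -/
theorem le_choose_of_starGraph_rep {k d p : ℕ} (S : Option (Fin k) → Finset (Fin d))
    (hS : ∀ u v, u ≠ v → ((starGraph k).Adj u v ↔ p ≤ (S u ∩ S v).card)) :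
    k ≤ d.choose p := by
  have common (i : Fin k) : ∃ T ⊆ S none ∩ S (some i), T.card = p :=
    exists_subset_card_eq ((hS _ _ (by simp)).1 (starGraph_adj_none_some i))
  choose T hTS hT using common
  have injective_T : Function.Injective T := by
    intro i j hij
    by_contra hne
    refine starGraph_not_adj_some_some i j ((hS _ _ (by simpa using hne)).2 ?_)
    rw [← hT i]
    refine card_le_card (subset_inter ((hTS i).trans inter_subset_right) ?_)
    rw [hij]
    exact (hTS j).trans inter_subset_right
  calc k = (univ : Finset (Fin k)).card := by simp
    _ ≤ (powersetCard p (univ : Finset (Fin d))).card :=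
        card_le_card_of_injOn T (fun i _ => by simp [mem_powersetCard, hT])
          injective_T.injOn
    _ = d.choose p := by simp

/-- For positive `p`, the star is represented on `k * p` points by giving the leaves pairwise
disjoint blocks of `p` points and the center every point. -/
theorem exists_starGraph_rep (k : ℕ) {p : ℕ} (hp : 0 < p) :
    ∃ S : Option (Fin k) → Finset (Fin (k * p)),
      ∀ u v, u ≠ v → ((starGraph k).Adj u v ↔ p ≤ (S u ∩ S v).card) := by
  let block (i : Fin k) : Finset (Fin (k * p)) :=
    (({i} : Finset (Fin k)) ×ˢ (univ : Finset (Fin p))).map finProdFinEquiv.toEmbedding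
  have card_block (i : Fin k) : (block i).card = p := by simp [block]
  have block_inter {i j : Fin k} (hij : i ≠ j) : block i ∩ block j = ∅ := by
    rw [← map_inter, product_inter_product, singleton_inter_of_notMem (by simpa using hij)]
    simp
  refine ⟨fun u => u.elim univ block, ?_⟩
  rintro (_ | i) (_ | j) huv
  · exact absurd rfl huv
  · simp [starGraph_adj_none_some, card_block]
  · simp [(starGraph_adj_none_some i).symm, card_block]
  · simp [starGraph_not_adj_some_some, block_inter (i := i) (j := j) (by simpa using huv), hp.ne']

/-- For positive integers `d` and `p`, the star `K_{1,k}` with `k = C(d,p) + 1`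
satisfies `Θ_p(K_{1,k}) > d`; that is, it has no binary dot product representation
of dimension `d` with threshold `p`. -/
theorem star_pIntersectionNumber_gt (d p : ℕ) (hd : 0 < d) (hp : 0 < p) :
    d < (starGraph (d.choose p + 1)).pIntersectionNumber p ∧
    ¬ ∃ f : Option (Fin (d.choose p + 1)) → (Fin d → Bool),
        (starGraph (d.choose p + 1)).IsBinaryDotRep d p f := by
  constructor
  · by_contra! h
    obtain ⟨S, hS⟩ : (starGraph (d.choose p + 1)).pIntersectionNumber p ∈
        {n : ℕ | ∃ S : _ → Finset (Fin n), ∀ u v, u ≠ v →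
          ((starGraph (d.choose p + 1)).Adj u v ↔ p ≤ (S u ∩ S v).card)} :=
      Nat.sInf_mem ⟨_, exists_starGraph_rep _ hp⟩
    exact absurd ((le_choose_of_starGraph_rep S hS).trans (Nat.choose_le_choose p h)) (by simp)
  · rintro ⟨f, hf⟩
    refine absurd (le_choose_of_starGraph_rep (fun u => univ.filter fun i => f u i = true) ?_)
      (Nat.not_succ_le_self (d.choose p))
    intro u v huv
    rw [hf u v huv, boolDot, filter_and]
end

section
/- Let d ≥ 2 be an integer and let G be a finite simple graph without isolated vertices. Then Θ_{d-1}(G) ≤ d if and only if G contains none of the following as an induced subgraph: the edgeless graph K̄_{d+1} on d+1 vertices, the path P₄ on four vertices, the disjoint union K₁ ∪ P₃ of a single vertex and a path on three vertices, and the cycle C₄ on four vertices. -/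
/-- `G` contains `F` as an induced subgraph. -/
def SimpleGraph.HasInducedCopy {α β : Type*} (F : SimpleGraph α)
    (G : SimpleGraph β) : Prop :=
  Nonempty (F ↪g G)

/-- The disjoint union `K₁ ∪ P₃` of a single vertex and a path on three vertices. -/
def K1uP3 : SimpleGraph (Fin 1 ⊕ Fin 3) :=
  (⊥ : SimpleGraph (Fin 1)) ⊕g SimpleGraph.pathGraph 3

namespace SimpleGraph

variable {V : Type*} {G : SimpleGraph V} {d p : ℕ}

/-- `G` has a `p`-intersection representation with ground set `Fin d`. -/
def HasIntersectionRep (G : SimpleGraph V) (p d : ℕ) : Prop :=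
  ∃ S : V → Finset (Fin d), ∀ u v : V, u ≠ v → (G.Adj u v ↔ p ≤ (S u ∩ S v).card)

/-- A labelling of the vertices witnessing that `G` is the join of a complete graph (label `none`)
with a disjoint union of at most `d` complete graphs (labels `some i`). -/
def IsCliqueJoinLabelling (G : SimpleGraph V) (f : V → Option (Fin d)) : Prop :=
  ∀ u v : V, u ≠ v → (G.Adj u v ↔ f u = none ∨ f v = none ∨ f u = f v)

theorem HasIntersectionRep.mono {k : ℕ} (h : G.HasIntersectionRep p k) (hkd : k ≤ d) :
    G.HasIntersectionRep p d := by
  obtain ⟨S, hS⟩ := h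
  refine ⟨fun v => (S v).map (Fin.castLEEmb hkd), fun u v huv => ?_⟩
  rw [← Finset.map_inter, Finset.card_map]
  exact hS u v huv

/-- Use the edges at each vertex, together with `p - 1` common elements. -/
theorem exists_hasIntersectionRep [Finite V] (G : SimpleGraph V) (hp : 1 ≤ p) :
    ∃ k, G.HasIntersectionRep p k := by
  classical
  have := Fintype.ofFinite V
  let T : V → Finset (Sym2 V ⊕ Fin (p - 1)) := fun v =>
    (G.incidenceFinset v).disjSum Finset.univ
  let e := Fintype.equivFin (Sym2 V ⊕ Fin (p - 1))
  refine ⟨_, fun v => (T v).map e.toEmbedding, fun u v huv => ?_⟩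
  have hT : T u ∩ T v =
      (G.incidenceFinset u ∩ G.incidenceFinset v).disjSum Finset.univ := by
    ext (x | x) <;> simp [T]
  rw [← Finset.map_inter, Finset.card_map, hT, Finset.card_disjSum, Finset.card_univ,
    Fintype.card_fin]
  by_cases h : G.Adj u v
  · have hmem : s(u, v) ∈ G.incidenceFinset u ∩ G.incidenceFinset v := by
      simp [mem_incidenceFinset, incidenceSet, h]
    have := Finset.card_pos.mpr ⟨_, hmem⟩
    simp only [h, true_iff]
    omega
  · have hempty : G.incidenceFinset u ∩ G.incidenceFinset v = ∅ := by
      rw [← Finset.coe_inj]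
      simpa using G.incidenceSet_inter_incidenceSet_of_not_adj h huv
    simp only [h, hempty, Finset.card_empty, false_iff]
    omega

theorem pIntersectionNumber_le_iff [Finite V] (hp : 1 ≤ p) :
    G.pIntersectionNumber p ≤ d ↔ G.HasIntersectionRep p d := by
  refine ⟨fun h => ?_, fun h => Nat.sInf_le h⟩
  have hne : {k | G.HasIntersectionRep p k}.Nonempty := exists_hasIntersectionRep G hp
  exact HasIntersectionRep.mono (Nat.sInf_mem hne) h

theorem hasIntersectionRep_iff_exists_labelling (hd : 2 ≤ d)
    (hiso : ∀ v : V, ∃ w : V, G.Adj v w) :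
    G.HasIntersectionRep (d - 1) d ↔ ∃ f : V → Option (Fin d), G.IsCliqueJoinLabelling f := by
  have key : ∀ a b : Option (Fin d), d - 1 ≤ (a.toFinsetᶜ ∩ b.toFinsetᶜ).card ↔
      a = none ∨ b = none ∨ a = b := by
    intro a b
    rw [← Finset.compl_union, Finset.card_compl, Fintype.card_fin]
    rcases a with _ | a <;> rcases b with _ | b
    · simp
    · simp
    · simp
    · by_cases h : a = b
      · simp [h]
      · have : ({a} ∪ {b} : Finset (Fin d)).card = 2 := Finset.card_pair h
        simp only [Option.toFinset_some, this, reduceCtorEq, Option.some.injEq, h, false_or,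
          iff_false]
        omega
  constructor
  · rintro ⟨S, hS⟩
    have hlabel : ∀ v, ∃ a : Option (Fin d), S v = a.toFinsetᶜ := by
      intro v
      obtain ⟨w, hw⟩ := hiso v
      have h1 := (hS v w hw.ne).1 hw
      have h2 := Finset.card_le_card (Finset.inter_subset_left (s₁ := S v) (s₂ := S w))
      have h3 : (S v)ᶜ.card ≤ 1 := by
        rw [Finset.card_compl, Fintype.card_fin]
        omega
      rcases Nat.le_one_iff_eq_zero_or_eq_one.1 h3 with h | h
      · exact ⟨none, by simpa using h⟩
      · obtain ⟨x, hx⟩ := Finset.card_eq_one.1 h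
        exact ⟨some x, by rw [Option.toFinset_some, ← hx, compl_compl]⟩
    choose f hf using hlabel
    refine ⟨f, fun u v huv => ?_⟩
    rw [hS u v huv, hf u, hf v, key]
  · rintro ⟨f, hf⟩
    exact ⟨fun v => (f v).toFinsetᶜ, fun u v huv => by rw [hf u v huv, key]⟩

/-- The middle vertex of every induced `P₃` is adjacent to all other vertices. -/
def InducedP3Dominating (G : SimpleGraph V) : Prop :=
  ∀ a b c x : V, G.Adj a b → G.Adj b c → a ≠ c → ¬ G.Adj a c → x ≠ b → G.Adj b x

theorem IsCliqueJoinLabelling.inducedP3Dominating {f : V → Option (Fin d)}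
    (hf : G.IsCliqueJoinLabelling f) : G.InducedP3Dominating := by
  intro a b c x hab hbc hac hnac hxb
  have h1 := (hf a b hab.ne).1 hab
  have h2 := (hf b c hbc.ne).1 hbc
  have h3 := mt (hf a c hac).2 hnac
  rw [hf b x hxb.symm]
  grind

theorem IsCliqueJoinLabelling.not_hasInducedCopy_bot {f : V → Option (Fin d)}
    (hf : G.IsCliqueJoinLabelling f) (hd : 1 ≤ d) :
    ¬ HasInducedCopy (⊥ : SimpleGraph (Fin (d + 1))) G := by
  rintro ⟨e⟩
  have hno : ∀ i j, i ≠ j → f (e i) ≠ none ∧ f (e i) ≠ f (e j) := by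
    intro i j hij
    have hadj : ¬ G.Adj (e i) (e j) := by simp [e.map_rel_iff]
    rw [hf _ _ (e.injective.ne hij)] at hadj
    tauto
  have : Nontrivial (Fin (d + 1)) := Fin.nontrivial_iff_two_le.2 (by omega)
  have hsome : ∀ i, ∃ x, f (e i) = some x := fun i => by
    obtain ⟨j, hj⟩ := exists_ne i
    exact Option.ne_none_iff_exists'.1 (hno i j hj.symm).1
  choose g hg using hsome
  have hinj : Function.Injective g := fun i j hij => by
    by_contra hne
    exact (hno i j hne).2 (by rw [hg, hg, hij])
  simpa using Fintype.card_le_of_injective g hinj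

theorem HasInducedCopy.of_injective {α : Type*} {F : SimpleGraph α} (f : α → V)
    (hf : Function.Injective f) (hadj : ∀ i j, G.Adj (f i) (f j) ↔ F.Adj i j) :
    HasInducedCopy F G :=
  ⟨⟨⟨f, hf⟩, hadj _ _⟩⟩

theorem cycleGraph_four_adj :
    ∀ i j : Fin 4, (cycleGraph 4).Adj i j ↔ (i.val + j.val) % 2 = 1 := by
  decide

theorem inducedP3Dominating_iff :
    G.InducedP3Dominating ↔ ¬ HasInducedCopy (pathGraph 4) G ∧ ¬ HasInducedCopy K1uP3 G ∧
      ¬ HasInducedCopy (cycleGraph 4) G := by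
  constructor
  · intro h
    refine ⟨?_, ?_, ?_⟩
    · rintro ⟨e⟩
      have := h (e 0) (e 1) (e 2) (e 3) (e.map_rel_iff.2 (by simp [pathGraph_adj]))
        (e.map_rel_iff.2 (by simp [pathGraph_adj])) (e.injective.ne (by decide))
        (fun h => by simpa [pathGraph_adj] using e.map_rel_iff.1 h) (e.injective.ne (by decide))
      simpa [pathGraph_adj] using e.map_rel_iff.1 this
    · rintro ⟨e⟩
      have := h (e (.inr 0)) (e (.inr 1)) (e (.inr 2)) (e (.inl 0))
        (e.map_rel_iff.2 (by simp [K1uP3, pathGraph_adj]))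
        (e.map_rel_iff.2 (by simp [K1uP3, pathGraph_adj])) (e.injective.ne (by decide))
        (fun h => by simpa [K1uP3, pathGraph_adj] using e.map_rel_iff.1 h)
        (e.injective.ne (by decide))
      simpa [K1uP3] using e.map_rel_iff.1 this
    · rintro ⟨e⟩
      have := h (e 0) (e 1) (e 2) (e 3) (e.map_rel_iff.2 (by decide))
        (e.map_rel_iff.2 (by decide)) (e.injective.ne (by decide))
        (fun h => absurd (e.map_rel_iff.1 h) (by decide)) (e.injective.ne (by decide))
      exact absurd (e.map_rel_iff.1 this) (by decide)
  · rintro ⟨hP, hK, hC⟩ a b c x hab hbc hac hnac hxb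
    by_contra hbx
    have hxa : x ≠ a := by rintro rfl; exact hbx hab.symm
    have hxc : x ≠ c := by rintro rfl; exact hbx hbc
    have hab' := hab.ne
    have hbc' := hbc.ne
    by_cases h1 : G.Adj x a <;> by_cases h2 : G.Adj x c
    · refine hC (.of_injective ![x, a, b, c] ?_ ?_)
      · intro i j
        fin_cases i <;> fin_cases j <;> simp <;> grind
      · intro i j
        fin_cases i <;> fin_cases j <;> simp [cycleGraph_four_adj] <;> grind [G.adj_comm]
    · refine hP (.of_injective ![x, a, b, c] ?_ ?_)
      · intro i j
        fin_cases i <;> fin_cases j <;> simp <;> grind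
      · intro i j
        fin_cases i <;> fin_cases j <;> simp [pathGraph_adj] <;> grind [G.adj_comm]
    · refine hP (.of_injective ![a, b, c, x] ?_ ?_)
      · intro i j
        fin_cases i <;> fin_cases j <;> simp <;> grind
      · intro i j
        fin_cases i <;> fin_cases j <;> simp [pathGraph_adj] <;> grind [G.adj_comm]
    · refine hK (.of_injective (Sum.elim ![x] ![a, b, c]) ?_ ?_)
      · rintro (i | i) (j | j) <;> fin_cases i <;> fin_cases j <;> simp <;> grind
      · rintro (i | i) (j | j) <;> fin_cases i <;> fin_cases j <;>
          simp [K1uP3, pathGraph_adj] <;> grind [G.adj_comm]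

/-- Label the vertices that are not universal by the clique they belong to. -/
theorem InducedP3Dominating.exists_labelling [Finite V] (h : G.InducedP3Dominating)
    (hbot : ¬ HasInducedCopy (⊥ : SimpleGraph (Fin (d + 1))) G) :
    ∃ f : V → Option (Fin d), G.IsCliqueJoinLabelling f := by
  classical
  let W := {v : V // ∃ x, x ≠ v ∧ ¬ G.Adj v x}
  let s : Setoid W :=
    { r := fun u v => u = v ∨ G.Adj u.1 v.1
      iseqv :=
        { refl := fun _ => .inl rfl
          symm := fun h => h.imp Eq.symm Adj.symm
          trans := by
            rintro u ⟨v, x, hx, hvx⟩ w (rfl | huv) (rfl | hvw)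
            · exact .inl rfl
            · exact .inr hvw
            · exact .inr huv
            · by_contra hne
              rw [not_or] at hne
              exact hvx (h u.1 v w.1 x huv hvw (fun e => hne.1 (Subtype.ext e)) hne.2 hx) } }
  have := Fintype.ofFinite (Quotient s)
  have hcard : Fintype.card (Quotient s) ≤ d := by
    by_contra! hlt
    obtain ⟨e⟩ := Function.Embedding.nonempty_of_card_le (α := Fin (d + 1)) (β := Quotient s)
      (by simpa using hlt)
    refine hbot (.of_injective (fun i => (e i).out.1) (fun i j hij => ?_) fun i j => ?_)
    · exact e.injective (Quotient.out_injective (Subtype.ext hij))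
    · simp only [bot_adj, iff_false]
      intro hadj
      have : e i = e j := Quotient.out_equiv_out.1 (Or.inr hadj)
      rw [this] at hadj
      exact G.loopless.irrefl _ hadj
  obtain ⟨g⟩ := Function.Embedding.nonempty_of_card_le (α := Quotient s) (β := Fin d)
    (by simpa using hcard)
  refine ⟨fun v => if hv : ∃ x, x ≠ v ∧ ¬ G.Adj v x then some (g (Quotient.mk s ⟨v, hv⟩))
    else none, fun u v huv => ?_⟩
  by_cases hu : ∃ x, x ≠ u ∧ ¬ G.Adj u x
  · by_cases hv : ∃ x, x ≠ v ∧ ¬ G.Adj v x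
    · have hr : Quotient.mk s ⟨u, hu⟩ = Quotient.mk s ⟨v, hv⟩ ↔ G.Adj u v := by
        rw [Quotient.eq]
        change (_ = _ ∨ _) ↔ _
        exact or_iff_right fun e => huv (congrArg Subtype.val e)
      simp only [dif_pos hu, dif_pos hv]
      simp [hr]
    · have : G.Adj u v := by
        push Not at hv
        exact (hv u huv).symm
      simp only [this, dif_neg hv, true_or, or_true]
  · have : G.Adj u v := by
      push Not at hu
      exact hu v huv.symm
    simp only [this, dif_neg hu, true_or]

end SimpleGraph

/-- Theorem 3, (i) ⇔ (iii): for an integer `d ≥ 2` and a finite graph `G` without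
isolated vertices, `Θ_{d-1}(G) ≤ d` if and only if `G` contains none of
`K̄_{d+1}`, `P₄`, `K₁ ∪ P₃` and `C₄` as an induced subgraph. -/
theorem pIntersectionNumber_le_iff_forb {V : Type*} [Fintype V]
    (d : ℕ) (hd : 2 ≤ d) (G : SimpleGraph V)
    (hiso : ∀ v : V, ∃ w : V, G.Adj v w) :
    G.pIntersectionNumber (d - 1) ≤ d ↔
      (¬ SimpleGraph.HasInducedCopy (⊥ : SimpleGraph (Fin (d + 1))) G ∧
       ¬ SimpleGraph.HasInducedCopy (SimpleGraph.pathGraph 4) G ∧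
       ¬ SimpleGraph.HasInducedCopy K1uP3 G ∧
       ¬ SimpleGraph.HasInducedCopy (SimpleGraph.cycleGraph 4) G) := by
  rw [SimpleGraph.pIntersectionNumber_le_iff (by omega),
    SimpleGraph.hasIntersectionRep_iff_exists_labelling hd hiso,
    ← SimpleGraph.inducedP3Dominating_iff]
  exact ⟨fun ⟨_, hf⟩ => ⟨hf.not_hasInducedCopy_bot (by omega), hf.inducedP3Dominating⟩,
    fun ⟨hbot, hdom⟩ => hdom.exists_labelling hbot⟩
end

section
/- Let d ≥ 3 be an integer and let G be a finite simple graph without isolated vertices and without universal vertices. If f : V(G) → {0,1}^d is a binary dot product representation of G of dimension d with threshold d−2, then every vertex u of G satisfies d−2 ≤ f(u)·f(u) ≤ d−1; that is, f(u) has exactly one or exactly two zero entries. -/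
/-- The dot product of two 0/1-vectors is at most the weight of the first. -/
theorem boolDot_le_self {d : ℕ} (x y : Fin d → Bool) : boolDot x y ≤ boolDot x x := by
  refine Finset.card_le_card fun i hi => ?_
  simp only [Finset.mem_filter] at hi ⊢
  exact ⟨hi.1, hi.2.1, hi.2.1⟩

/-- A 0/1-vector of weight at least `d` has no zero entry. -/
theorem eq_true_of_le_boolDot_self {d : ℕ} {x : Fin d → Bool} (h : d ≤ boolDot x x)
    (i : Fin d) : x i = true := by
  have hcard : (Finset.univ.filter fun i => x i = true ∧ x i = true) = Finset.univ := by
    rw [← Finset.card_eq_iff_eq_univ, Fintype.card_fin]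
    exact le_antisymm ((Finset.card_le_univ _).trans_eq (Fintype.card_fin d)) h
  have hi := Finset.mem_univ i
  rw [← hcard, Finset.mem_filter] at hi
  exact hi.2.1

/-- For an integer `d ≥ 3` and a finite graph `G` without isolated or universal
vertices, any binary dot product representation `f` of `G` of dimension `d` with
threshold `d-2` satisfies `d-2 ≤ f(u)·f(u) ≤ d-1` for every vertex `u`; that is,
`f(u)` has exactly one or exactly two zero entries. -/
theorem dotRep_selfDot_bounds {V : Type*} [Fintype V]
    (d : ℕ) (hd : 3 ≤ d) (G : SimpleGraph V)
    (hiso : ∀ v : V, ∃ w : V, G.Adj v w)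
    (huniv : ∀ v : V, ∃ w : V, w ≠ v ∧ ¬ G.Adj v w)
    (f : V → (Fin d → Bool)) (hf : G.IsBinaryDotRep d (d - 2) f) :
    ∀ u : V, d - 2 ≤ boolDot (f u) (f u) ∧ boolDot (f u) (f u) ≤ d - 1 := by
  have hlow : ∀ u : V, d - 2 ≤ boolDot (f u) (f u) := fun u => by
    obtain ⟨w, hw⟩ := hiso u
    exact ((hf u w hw.ne).1 hw).trans (boolDot_le_self _ _)
  refine fun u => ⟨hlow u, ?_⟩
  by_contra hlt
  have hone := eq_true_of_le_boolDot_self (x := f u) (by omega)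
  obtain ⟨w, hne, hnadj⟩ := huniv u
  refine hnadj ((hf u w hne.symm).2 ((hlow w).trans_eq ?_))
  simp [boolDot, hone]
end

section
/- Let d ≥ 3 be an integer, let G be a finite simple graph, and let f : V(G) → {0,1}^d be a binary dot product representation of G of dimension d with threshold d−2 such that d−2 ≤ f(u)·f(u) ≤ d−1 for every vertex u. Let C = {u ∈ V(G) : f(u)·f(u) = d−1} and I = {u ∈ V(G) : f(u)·f(u) = d−2}. Then C is a clique of G; and if moreover f is injective on C ∪ I, then |C| ≤ d, I is an independent set of size at most C(d,2), every vertex of I has at most two neighbors in C, and any two distinct vertices of C have at most one common neighbor in I. -/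
/-- The set of coordinates at which a 0/1-vector vanishes. -/
def zeroCoords {d : ℕ} (x : Fin d → Bool) : Finset (Fin d) :=
  Finset.univ.filter fun i => x i = false

theorem zeroCoords_injective {d : ℕ} : Function.Injective (zeroCoords (d := d)) := by
  intro x y h
  funext i
  have hi : i ∈ zeroCoords x ↔ i ∈ zeroCoords y := by rw [h]
  simp only [zeroCoords, Finset.mem_filter, Finset.mem_univ, true_and] at hi
  cases hx : x i <;> cases hy : y i <;> simp_all

theorem boolDot_add_card_zeroCoords_union {d : ℕ} (x y : Fin d → Bool) :
    boolDot x y + (zeroCoords x ∪ zeroCoords y).card = d := by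
  have h : zeroCoords x ∪ zeroCoords y =
      Finset.univ.filter fun i => ¬ (x i = true ∧ y i = true) := by
    ext i
    cases hx : x i <;> cases hy : y i <;> simp [zeroCoords, hx, hy]
  rw [h, boolDot, Finset.card_filter_add_card_filter_not, Finset.card_univ, Fintype.card_fin]

theorem boolDot_self_add_card_zeroCoords {d : ℕ} (x : Fin d → Bool) :
    boolDot x x + (zeroCoords x).card = d := by
  simpa using boolDot_add_card_zeroCoords_union x x

/-- A set that some function embeds into the `k`-subsets of `t` has at most `C(|t|, k)` elements. -/
theorem Set.ncard_le_choose_of_injOn {V α : Type*} {S : Set V} {g : V → Finset α}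
    {t : Finset α} {k : ℕ} (hg : Set.InjOn g S) (hsub : ∀ v ∈ S, g v ⊆ t)
    (hcard : ∀ v ∈ S, (g v).card = k) : S.ncard ≤ t.card.choose k := by
  rw [← Finset.card_powersetCard, ← Set.ncard_coe_finset]
  refine Set.ncard_le_ncard_of_injOn g (fun v hv => ?_) hg
  simpa using ⟨hsub v hv, hcard v hv⟩

/-- Let `f` be a binary dot product representation of a finite graph `G` of
dimension `d ≥ 3` with threshold `d-2` such that `d-2 ≤ f(u)·f(u) ≤ d-1` for all
`u`, and let `C = {u : f(u)·f(u) = d-1}` and `I = {u : f(u)·f(u) = d-2}`.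
Then `C` is a clique; and if `f` is injective on `C ∪ I`, then `|C| ≤ d`, `I` is
an independent set of size at most `C(d,2)`, every vertex of `I` has at most two
neighbors in `C`, and any two distinct vertices of `C` have at most one common
neighbor in `I`. -/
theorem dotRep_clique_indep_structure {V : Type*} [Fintype V]
    (d : ℕ) (hd : 3 ≤ d) (G : SimpleGraph V)
    (f : V → (Fin d → Bool)) (hf : G.IsBinaryDotRep d (d - 2) f)
    (hbounds : ∀ u : V, d - 2 ≤ boolDot (f u) (f u) ∧ boolDot (f u) (f u) ≤ d - 1) :
    G.IsClique {u : V | boolDot (f u) (f u) = d - 1} ∧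
    (Set.InjOn f ({u : V | boolDot (f u) (f u) = d - 1} ∪
        {u : V | boolDot (f u) (f u) = d - 2}) →
      ({u : V | boolDot (f u) (f u) = d - 1}.ncard ≤ d ∧
       ({u : V | boolDot (f u) (f u) = d - 2}.Pairwise fun u v => ¬ G.Adj u v) ∧
       {u : V | boolDot (f u) (f u) = d - 2}.ncard ≤ d.choose 2 ∧
       (∀ u : V, boolDot (f u) (f u) = d - 2 →
         {c : V | boolDot (f c) (f c) = d - 1 ∧ G.Adj u c}.ncard ≤ 2) ∧
       (∀ c₁ c₂ : V, boolDot (f c₁) (f c₁) = d - 1 → boolDot (f c₂) (f c₂) = d - 1 →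
         c₁ ≠ c₂ →
         {u : V | boolDot (f u) (f u) = d - 2 ∧ G.Adj u c₁ ∧ G.Adj u c₂}.ncard ≤ 1))) := by
  have hunion := fun u v => boolDot_add_card_zeroCoords_union (f u) (f v)
  have hself := fun u => boolDot_self_add_card_zeroCoords (f u)
  have hC : ∀ {u}, boolDot (f u) (f u) = d - 1 → (zeroCoords (f u)).card = 1 := by
    intro u hu
    have := hself u
    omega
  have hI : ∀ {u}, boolDot (f u) (f u) = d - 2 → (zeroCoords (f u)).card = 2 := by
    intro u hu
    have := hself u
    omega
  -- The neighbors of a vertex of `I` are those whose zero set is contained in its own.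
  have hsub : ∀ {u v}, boolDot (f u) (f u) = d - 2 → G.Adj u v →
      zeroCoords (f v) ⊆ zeroCoords (f u) := by
    intro u v hu huv
    have hdot := (hf u v huv.ne).1 huv
    have huniv := hunion u v
    have hucard := hI hu
    rw [Finset.eq_of_subset_of_card_le
      (Finset.subset_union_left (s₁ := zeroCoords (f u)) (s₂ := zeroCoords (f v))) (by omega)]
    exact Finset.subset_union_right
  refine ⟨fun u hu v hv huv => (hf u v huv).2 ?_, fun hinj => ?_⟩
  · have := hunion u v
    have := Finset.card_union_le (zeroCoords (f u)) (zeroCoords (f v))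
    have := hC hu
    have := hC hv
    omega
  have hZ : Function.Injective fun u => zeroCoords (f u) := by
    intro u v huv
    have hmem : ∀ w, w ∈ {u : V | boolDot (f u) (f u) = d - 1} ∪
        {u : V | boolDot (f u) (f u) = d - 2} := by
      intro w
      have := hbounds w
      simp only [Set.mem_union, Set.mem_ofPred_eq]
      omega
    exact hinj (hmem u) (hmem v) (zeroCoords_injective huv)
  refine ⟨?_, fun u hu v hv huv hadj => ?_, ?_, fun u hu => ?_, fun c₁ c₂ h₁ h₂ hne => ?_⟩
  · simpa using Set.ncard_le_choose_of_injOn (t := Finset.univ)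
      (S := {u : V | boolDot (f u) (f u) = d - 1}) hZ.injOn
      (fun v _ => Finset.subset_univ _) fun v hv => hC hv
  · exact huv (hZ (Finset.eq_of_subset_of_card_le (hsub hv hadj.symm)
      ((hI hv).trans (hI hu).symm).le))
  · simpa using Set.ncard_le_choose_of_injOn (t := Finset.univ)
      (S := {u : V | boolDot (f u) (f u) = d - 2}) hZ.injOn
      (fun v _ => Finset.subset_univ _) fun v hv => hI hv
  · simpa [hI hu] using Set.ncard_le_choose_of_injOn (t := zeroCoords (f u))
      (S := {c : V | boolDot (f c) (f c) = d - 1 ∧ G.Adj u c}) hZ.injOn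
      (fun c hc => hsub hu hc.2) fun c hc => hC hc.1
  · have hdisj : Disjoint (zeroCoords (f c₁)) (zeroCoords (f c₂)) := by
      obtain ⟨a, ha⟩ := Finset.card_eq_one.1 (hC h₁)
      obtain ⟨b, hb⟩ := Finset.card_eq_one.1 (hC h₂)
      have hab : a ≠ b := fun h => hne (hZ (by simp only [ha, hb, h]))
      simpa [ha, hb] using hab
    have hcard : (zeroCoords (f c₁) ∪ zeroCoords (f c₂)).card = 2 := by
      rw [Finset.card_union_of_disjoint hdisj, hC h₁, hC h₂]
    have hdet : ∀ u, boolDot (f u) (f u) = d - 2 ∧ G.Adj u c₁ ∧ G.Adj u c₂ →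
        zeroCoords (f c₁) ∪ zeroCoords (f c₂) = zeroCoords (f u) := fun u hu =>
      Finset.eq_of_subset_of_card_le
        (Finset.union_subset (hsub hu.1 hu.2.1) (hsub hu.1 hu.2.2))
        ((hI hu.1).trans hcard.symm).le
    exact (Set.ncard_le_one_iff (Set.toFinite _)).2 fun ha hb => hZ ((hdet _ ha).symm.trans (hdet _ hb))
end

section
/- Let d ≥ 3 be an integer and let G be a finite simple graph without isolated vertices and without universal vertices in which no two vertices are twins. If Θ_{d-2}(G) ≤ d, then G contains none of 2K₂, C₅, and K_{2,3}+e as an induced subgraph. -/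
/-- Two vertices are twins if they have the same open neighborhood or the same
closed neighborhood. -/
def SimpleGraph.IsTwinPair {V : Type*} (G : SimpleGraph V) (u v : V) : Prop :=
  G.neighborSet u = G.neighborSet v ∨
    insert u (G.neighborSet u) = insert v (G.neighborSet v)

/-- `2K₂`: the disjoint union of two edges. -/
def twoK2 : SimpleGraph (Fin 4) :=
  SimpleGraph.fromRel (fun a b => (a = 0 ∧ b = 1) ∨ (a = 2 ∧ b = 3))

/-- `K_{2,3}+e`: complete bipartite graph with parts `{0,1}` and `{2,3,4}` plus
the edge `01` between the two vertices of degree 3. -/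
def K23e : SimpleGraph (Fin 5) :=
  SimpleGraph.fromRel (fun a b => ((a : ℕ) < 2 ∧ 2 ≤ (b : ℕ)) ∨ (a = 0 ∧ b = 1))

namespace SimpleGraph

variable {V : Type*} {G : SimpleGraph V}

/-- A finite graph has a `p`-intersection representation for every positive `p`: give each vertex
`p` private elements for each of its incident edges. -/
theorem exists_pIntersection_representation [Finite V] (G : SimpleGraph V) {p : ℕ} (hp : 0 < p) :
    ∃ (n : ℕ) (S : V → Finset (Fin n)),
      ∀ u v : V, u ≠ v → (G.Adj u v ↔ p ≤ (S u ∩ S v).card) := by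
  classical
  have := Fintype.ofFinite V
  let R : V → Finset (Sym2 V × Fin p) := fun u ↦ (G.incidenceFinset u) ×ˢ Finset.univ
  let e := Fintype.equivFin (Sym2 V × Fin p)
  refine ⟨_, fun u ↦ (R u).map e.toEmbedding, fun u v huv ↦ ?_⟩
  rw [← Finset.map_inter, Finset.card_map, ← Finset.inter_product, Finset.card_product,
    Finset.card_univ, Fintype.card_fin]
  constructor
  · intro h
    refine Nat.le_mul_of_pos_left p (Finset.card_pos.2 ⟨s(u, v), ?_⟩)
    simpa [h, mem_incidenceSet] using G.mk'_mem_incidenceSet_right_iff.2 h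
  · intro h
    have hpos := Nat.pos_of_mul_pos_right (hp.trans_le h)
    obtain ⟨x, hx⟩ := Finset.card_pos.1 hpos
    simp only [Finset.mem_inter, mem_incidenceFinset] at hx
    exact G.adj_of_mem_incidenceSet huv hx.1 hx.2

/-- If `Θ_{d-2}(G) ≤ d`, complements of the sets of a representation describe adjacency by unions
of at most two elements. -/
theorem exists_union_representation [Finite V] {d : ℕ} (hd : 3 ≤ d)
    (hθ : G.pIntersectionNumber (d - 2) ≤ d) :
    ∃ T : V → Finset (Fin d), ∀ u v : V, u ≠ v → (G.Adj u v ↔ (T u ∪ T v).card ≤ 2) := by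
  obtain ⟨S, hS⟩ : ∃ S : V → Finset (Fin (G.pIntersectionNumber (d - 2))),
      ∀ u v : V, u ≠ v → (G.Adj u v ↔ d - 2 ≤ (S u ∩ S v).card) :=
    Nat.sInf_mem (G.exists_pIntersection_representation (p := d - 2) (by omega))
  refine ⟨fun u ↦ ((S u).map (Fin.castLEEmb hθ))ᶜ, fun u v huv ↦ ?_⟩
  rw [hS u v huv, ← Finset.compl_inter, ← Finset.map_inter, Finset.card_compl, Finset.card_map,
    Fintype.card_fin]
  omega

/-- The vertices of `G` are distinct singletons and pairs, two of which are adjacent exactly when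
their union has at most two elements. -/
structure IsSmallUnionRepresentation {α : Type*} [DecidableEq α] (G : SimpleGraph V)
    (T : V → Finset α) : Prop where
  adj_iff : ∀ u v : V, u ≠ v → (G.Adj u v ↔ (T u ∪ T v).card ≤ 2)
  injective : Function.Injective T
  card_eq : ∀ v, (T v).card = 1 ∨ (T v).card = 2

theorem exists_isSmallUnionRepresentation [Finite V] {d : ℕ} (hd : 3 ≤ d)
    (hiso : ∀ v : V, ∃ w : V, G.Adj v w)
    (huniv : ∀ v : V, ∃ w : V, w ≠ v ∧ ¬ G.Adj v w)
    (htwin : ∀ u v : V, u ≠ v → ¬ G.IsTwinPair u v)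
    (hθ : G.pIntersectionNumber (d - 2) ≤ d) :
    ∃ T : V → Finset (Fin d), G.IsSmallUnionRepresentation T := by
  obtain ⟨T, hT⟩ := exists_union_representation hd hθ
  have card_le (v : V) : (T v).card ≤ 2 := by
    obtain ⟨w, hw⟩ := hiso v
    exact (Finset.card_le_card Finset.subset_union_left).trans ((hT v w hw.ne).1 hw)
  refine ⟨T, hT, fun u v huv ↦ ?_, fun v ↦ ?_⟩
  · by_contra hne
    have hadj : G.Adj u v := (hT u v hne).2 (by simpa [huv] using card_le v)
    refine htwin u v hne (Or.inr (Set.ext fun w ↦ ?_))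
    simp only [Set.mem_insert_iff, mem_neighborSet]
    rcases eq_or_ne w u with rfl | hwu
    · simp [hadj.symm]
    rcases eq_or_ne w v with rfl | hwv
    · simp [hadj]
    simp [hwu, hwv, hT u w hwu.symm, hT v w hwv.symm, huv]
  · obtain ⟨w, hwv, hw⟩ := huniv v
    have hpos : (T v).card ≠ 0 := fun h ↦ hw <| (hT v w hwv.symm).2 <| by
      simpa [Finset.card_eq_zero.1 h] using card_le w
    have := card_le v
    omega

namespace IsSmallUnionRepresentation

variable {α : Type*} [DecidableEq α] {T : V → Finset α}

theorem union_eq (hT : G.IsSmallUnionRepresentation T) {u w : V} (h : G.Adj u w)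
    (hw : (T w).card = 2) : T u ∪ T w = T w :=
  (Finset.eq_of_subset_of_card_le Finset.subset_union_right
    (((hT.adj_iff u w h.ne).1 h).trans_eq hw.symm)).symm

theorem card_eq_one_of_adj (hT : G.IsSmallUnionRepresentation T) {u v : V} (h : G.Adj u v) :
    (T u).card = 1 ∨ (T v).card = 1 := by
  by_contra! hne
  have hu := (hT.card_eq u).resolve_left hne.1
  have hv := (hT.card_eq v).resolve_left hne.2
  refine h.ne (hT.injective ?_)
  rw [← hT.union_eq h hv, Finset.union_comm, hT.union_eq h.symm hu]

theorem adj_of_card_eq_one (hT : G.IsSmallUnionRepresentation T) {u v : V} (h : u ≠ v)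
    (hu : (T u).card = 1) (hv : (T v).card = 1) : G.Adj u v :=
  (hT.adj_iff u v h).2 ((Finset.card_union_le _ _).trans (by omega))

/-- A pair is determined by two of its neighbors. -/
theorem eq_union (hT : G.IsSmallUnionRepresentation T) {u v w : V} (huv : u ≠ v)
    (hu : G.Adj u w) (hv : G.Adj v w) (hw : (T w).card ≠ 1) : T w = T u ∪ T v := by
  have hw2 := (hT.card_eq w).resolve_left hw
  have hu1 := (hT.card_eq_one_of_adj hu).resolve_right hw
  have hv1 := (hT.card_eq_one_of_adj hv).resolve_right hw
  have hdisj : T u ≠ T v := fun h ↦ huv (hT.injective h)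
  obtain ⟨a, ha⟩ := Finset.card_eq_one.1 hu1
  obtain ⟨b, hb⟩ := Finset.card_eq_one.1 hv1
  have hab : a ≠ b := by rintro rfl; exact hdisj (ha.trans hb.symm)
  refine (Finset.eq_of_subset_of_card_le (Finset.union_subset
    (Finset.union_eq_right.1 (hT.union_eq hu hw2))
    (Finset.union_eq_right.1 (hT.union_eq hv hw2))) ?_).symm
  rw [hw2, ha, hb, ← Finset.insert_eq, Finset.card_pair hab]

theorem not_hasInducedCopy_twoK2 (hT : G.IsSmallUnionRepresentation T) :
    ¬ HasInducedCopy twoK2 G := by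
  rintro ⟨f⟩
  have adj (i j : Fin 4) (h : twoK2.Adj i j) := hT.card_eq_one_of_adj (f.map_adj_iff.2 h)
  have nonadj (i j : Fin 4) (hij : i ≠ j) (h : ¬ twoK2.Adj i j)
      (hi : (T (f i)).card = 1) (hj : (T (f j)).card = 1) : False :=
    h (f.map_adj_iff.1 (hT.adj_of_card_eq_one (f.injective.ne hij) hi hj))
  rcases adj 0 1 (by simp [twoK2]) with h | h <;> rcases adj 2 3 (by simp [twoK2]) with h' | h' <;>
    exact nonadj _ _ (by decide) (by simp [twoK2]) h h'

theorem not_hasInducedCopy_cycleGraph_five (hT : G.IsSmallUnionRepresentation T) :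
    ¬ HasInducedCopy (cycleGraph 5) G := by
  rintro ⟨f⟩
  have adj (i : Fin 5) : (T (f i)).card = 1 ∨ (T (f (i + 1))).card = 1 :=
    hT.card_eq_one_of_adj (f.map_adj_iff.2 (by revert i; decide))
  have nonadj (i : Fin 5) (hi : (T (f i)).card = 1) (hj : (T (f (i + 2))).card = 1) : False := by
    have h : ∀ k : Fin 5, ¬ (cycleGraph 5).Adj k (k + 2) := by decide
    exact h i (f.map_adj_iff.1 (hT.adj_of_card_eq_one (f.injective.ne (by simp)) hi hj))
  have a0 := adj 0
  have a1 := adj 1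
  have a2 := adj 2
  have a3 := adj 3
  have a4 := adj 4
  have n0 := nonadj 0
  have n1 := nonadj 1
  have n2 := nonadj 2
  have n3 := nonadj 3
  have n4 := nonadj 4
  simp only [Fin.reduceAdd] at *
  tauto

theorem not_hasInducedCopy_K23e (hT : G.IsSmallUnionRepresentation T) :
    ¬ HasInducedCopy K23e G := by
  rintro ⟨f⟩
  have pair_unique (i j : Fin 5) (hi : 2 ≤ (i : ℕ)) (hj : 2 ≤ (j : ℕ)) (hij : i ≠ j) :
      (T (f i)).card = 1 ∨ (T (f j)).card = 1 := by
    by_contra! h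
    have adj0 (k : Fin 5) (hk : 2 ≤ (k : ℕ)) : G.Adj (f 0) (f k) :=
      f.map_adj_iff.2 (by simp [K23e, hk]; rintro rfl; simp at hk)
    have adj1 (k : Fin 5) (hk : 2 ≤ (k : ℕ)) : G.Adj (f 1) (f k) :=
      f.map_adj_iff.2 (by simp [K23e, hk]; rintro rfl; simp at hk)
    have h01 : f 0 ≠ f 1 := f.injective.ne (by decide)
    exact hij (f.injective (hT.injective
      ((hT.eq_union h01 (adj0 i hi) (adj1 i hi) h.1).trans
        (hT.eq_union h01 (adj0 j hj) (adj1 j hj) h.2).symm)))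
  have singleton_unique (i j : Fin 5) (hi : 2 ≤ (i : ℕ)) (hj : 2 ≤ (j : ℕ)) (hij : i ≠ j)
      (hi1 : (T (f i)).card = 1) (hj1 : (T (f j)).card = 1) : False := by
    have h := f.map_adj_iff.1 (hT.adj_of_card_eq_one (f.injective.ne hij) hi1 hj1)
    simp only [K23e, fromRel_adj, Fin.ext_iff] at h
    simp at h
    omega
  have p23 := pair_unique 2 3 (by decide) (by decide) (by decide)
  have p24 := pair_unique 2 4 (by decide) (by decide) (by decide)
  have p34 := pair_unique 3 4 (by decide) (by decide) (by decide)
  have s23 := singleton_unique 2 3 (by decide) (by decide) (by decide)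
  have s24 := singleton_unique 2 4 (by decide) (by decide) (by decide)
  have s34 := singleton_unique 3 4 (by decide) (by decide) (by decide)
  tauto

end IsSmallUnionRepresentation

end SimpleGraph

/-- For an integer `d ≥ 3` and a finite twin-free graph `G` without isolated or
universal vertices, if `Θ_{d-2}(G) ≤ d` then `G` contains none of `2K₂`, `C₅` and
`K_{2,3}+e` as an induced subgraph. -/
theorem forb_2K2_C5_K23e {V : Type*} [Fintype V]
    (d : ℕ) (hd : 3 ≤ d) (G : SimpleGraph V)
    (hiso : ∀ v : V, ∃ w : V, G.Adj v w)
    (huniv : ∀ v : V, ∃ w : V, w ≠ v ∧ ¬ G.Adj v w)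
    (htwin : ∀ u v : V, u ≠ v → ¬ G.IsTwinPair u v)
    (hθ : G.pIntersectionNumber (d - 2) ≤ d) :
    ¬ SimpleGraph.HasInducedCopy twoK2 G ∧
    ¬ SimpleGraph.HasInducedCopy (SimpleGraph.cycleGraph 5) G ∧
    ¬ SimpleGraph.HasInducedCopy K23e G := by
  obtain ⟨T, hT⟩ := SimpleGraph.exists_isSmallUnionRepresentation hd hiso huniv htwin hθ
  exact ⟨hT.not_hasInducedCopy_twoK2, hT.not_hasInducedCopy_cycleGraph_five,
    hT.not_hasInducedCopy_K23e⟩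
end
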